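/- Let (z, ρ) be a solution of the meridian-plane equations of motion with ż(0) = ρ̇(0) = 0, and suppose T > 0 is the minimal positive period of the pair (z, ρ). Then t = T/2 is the only time in the open interval (0, T) at which ż(t) = 0 and ρ̇(t) = 0. -/

import Mathlib

/-- Right-hand side of the `z` equation of motion in the meridian plane. -/
noncomputable def fZ (z ρ : ℝ) : ℝ :=
  -3 * z * ρ * (1 / ρ - ρ / (z ^ 2 + ρ ^ 2) ^ ((3 : ℝ) / 2)) / (z ^ 2 + ρ ^ 2) ^ ((5 : ℝ) / 2)

/-- Right-hand side of the `ρ` equation of motion in the meridian plane. -/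
noncomputable def gR (z ρ : ℝ) : ℝ :=
  (1 / ρ ^ 2 - 3 * ρ ^ 2 / (z ^ 2 + ρ ^ 2) ^ ((5 : ℝ) / 2)
      + 1 / (z ^ 2 + ρ ^ 2) ^ ((3 : ℝ) / 2))
    * (1 / ρ - ρ / (z ^ 2 + ρ ^ 2) ^ ((3 : ℝ) / 2))

/-- `(z, ρ)` is a solution of the meridian-plane equations of motion:
twice continuously differentiable, `ρ > 0` everywhere, and
`z̈ = fZ (z, ρ)`, `ρ̈ = gR (z, ρ)`. -/
def IsSolution (z ρ : ℝ → ℝ) : Prop :=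
  ContDiff ℝ 2 z ∧ ContDiff ℝ 2 ρ ∧ (∀ t, 0 < ρ t) ∧
    (∀ t, deriv (deriv z) t = fZ (z t) (ρ t)) ∧
    (∀ t, deriv (deriv ρ) t = gR (z t) (ρ t))

open Topology in
/-- Two global integral curves, through points where the vector field is continuously
differentiable, agree everywhere if they agree at one time. -/
theorem eq_of_hasDerivAt_of_contDiffAt {E : Type*} [NormedAddCommGroup E] [NormedSpace ℝ E]
    {v : E → E} {f g : ℝ → E} (hv : ∀ t, ContDiffAt ℝ 1 v (f t))
    (hf : ∀ t, HasDerivAt f (v (f t)) t) (hg : ∀ t, HasDerivAt g (v (g t)) t)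
    {t₀ : ℝ} (h : f t₀ = g t₀) : f = g := by
  have hfc : Continuous f := continuous_iff_continuousAt.2 fun t => (hf t).continuousAt
  have hgc : Continuous g := continuous_iff_continuousAt.2 fun t => (hg t).continuousAt
  have hclopen : IsClopen {t | f t = g t} := by
    refine ⟨isClosed_eq hfc hgc, isOpen_iff_mem_nhds.2 fun t ht => ?_⟩
    obtain ⟨K, s, hs, hK⟩ := (hv t).exists_lipschitzOnWith
    have hfs : ∀ᶠ x in 𝓝 t, f x ∈ s := hfc.continuousAt hs
    have hgs : ∀ᶠ x in 𝓝 t, g x ∈ s :=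
      hgc.continuousAt (by rwa [← show f t = g t from ht])
    exact ODE_solution_unique_of_eventually (v := fun _ => v) (s := fun _ => s)
      (Filter.Eventually.of_forall fun _ => hK) (hfs.mono fun x hx => ⟨hf x, hx⟩)
      (hgs.mono fun x hx => ⟨hg x, hx⟩) ht
  have huniv := hclopen.eq_univ ⟨t₀, h⟩
  funext t
  exact huniv.ge (Set.mem_univ t)

/-- The vector field of the first-order system on positions and velocities. -/
noncomputable def meridianField (x : (ℝ × ℝ) × (ℝ × ℝ)) : (ℝ × ℝ) × (ℝ × ℝ) :=
  (x.2, (fZ x.1.1 x.1.2, gR x.1.1 x.1.2))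

theorem contDiffAt_meridianField {x : (ℝ × ℝ) × (ℝ × ℝ)} (hx : 0 < x.1.2) :
    ContDiffAt ℝ 1 meridianField x := by
  have hr : 0 < x.1.1 ^ 2 + x.1.2 ^ 2 := by positivity
  have hpow (p : ℝ) : ContDiffAt ℝ 1
      (fun x : (ℝ × ℝ) × (ℝ × ℝ) => (x.1.1 ^ 2 + x.1.2 ^ 2) ^ p) x :=
    ContDiffAt.rpow_const_of_ne (by fun_prop) hr.ne'
  have h3 := hpow (3 / 2)
  have h5 := hpow (5 / 2)
  have n3 : (x.1.1 ^ 2 + x.1.2 ^ 2) ^ ((3 : ℝ) / 2) ≠ 0 := by positivity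
  have n5 : (x.1.1 ^ 2 + x.1.2 ^ 2) ^ ((5 : ℝ) / 2) ≠ 0 := by positivity
  have n2 : x.1.2 ^ 2 ≠ 0 := by positivity
  have hρ : ContDiffAt ℝ 1 (fun x : (ℝ × ℝ) × (ℝ × ℝ) => x.1.2) x := by fun_prop
  have hz : ContDiffAt ℝ 1 (fun x : (ℝ × ℝ) × (ℝ × ℝ) => x.1.1) x := by fun_prop
  have hA := (contDiffAt_const (c := (1 : ℝ))).div hρ hx.ne' |>.sub (hρ.div h3 n3)
  have hB := ((contDiffAt_const (c := (1 : ℝ))).div (hρ.pow 2) n2).sub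
    (((contDiffAt_const (c := (3 : ℝ))).mul (hρ.pow 2)).div h5 n5) |>.add
    ((contDiffAt_const (c := (1 : ℝ))).div h3 n3)
  exact contDiffAt_snd.prodMk
    (((((contDiffAt_const (c := (-3 : ℝ))).mul hz).mul hρ).mul hA |>.div h5 n5).prodMk
      (hB.mul hA))

namespace IsSolution

variable {z ρ : ℝ → ℝ}

theorem hasDerivAt (h : IsSolution z ρ) (t : ℝ) :
    HasDerivAt z (deriv z t) t ∧ HasDerivAt ρ (deriv ρ t) t ∧
      HasDerivAt (deriv z) (fZ (z t) (ρ t)) t ∧ HasDerivAt (deriv ρ) (gR (z t) (ρ t)) t := by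
  obtain ⟨hz, hρ, -, hz2, hρ2⟩ := h
  refine ⟨(hz.differentiable (by norm_num) t).hasDerivAt,
    (hρ.differentiable (by norm_num) t).hasDerivAt, ?_, ?_⟩
  · rw [← hz2]
    exact (hz.differentiable_deriv_two t).hasDerivAt
  · rw [← hρ2]
    exact (hρ.differentiable_deriv_two t).hasDerivAt

/-- A solution is symmetric in time about any instant at which it is at rest. -/
theorem reflect (h : IsSolution z ρ) {s : ℝ} (hz : deriv z s = 0) (hρ : deriv ρ s = 0)
    (t : ℝ) : z (2 * s - t) = z t ∧ ρ (2 * s - t) = ρ t := by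
  have key := eq_of_hasDerivAt_of_contDiffAt (v := meridianField)
    (f := fun t => ((z t, ρ t), (deriv z t, deriv ρ t)))
    (g := fun t => ((z (2 * s - t), ρ (2 * s - t)),
      (-deriv z (2 * s - t), -deriv ρ (2 * s - t))))
    (fun t => contDiffAt_meridianField (h.2.2.1 t))
    (fun t => by
      obtain ⟨h1, h2, h3, h4⟩ := h.hasDerivAt t
      exact (h1.prodMk h2).prodMk (h3.prodMk h4))
    (fun t => by
      obtain ⟨h1, h2, h3, h4⟩ := h.hasDerivAt (2 * s - t)
      have hr : HasDerivAt (fun t => 2 * s - t) (-1) t := (hasDerivAt_id t).const_sub (2 * s)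
      have H1 := h1.comp t hr
      have H2 := h2.comp t hr
      have H3 := (h3.comp t hr).neg
      have H4 := (h4.comp t hr).neg
      simp only [mul_neg, mul_one, neg_neg] at H1 H2 H3 H4
      exact (H1.prodMk H2).prodMk (H3.prodMk H4))
    (t₀ := s) (by simp [show 2 * s - s = s by ring, hz, hρ])
  have := congrFun key t
  simp only [Prod.mk.injEq] at this
  exact ⟨this.1.1.symm, this.1.2.symm⟩

end IsSolution

/-- The derivative of an even `T`-periodic function vanishes at `T / 2`. -/
theorem deriv_half_period_eq_zero {f : ℝ → ℝ} {T : ℝ} (heven : ∀ t, f (-t) = f t)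
    (hper : ∀ t, f (t + T) = f t) : deriv f (T / 2) = 0 := by
  have hsymm : (fun t => f (T - t)) = f := by
    funext t
    rw [← heven t, ← hper (-t)]
    ring_nf
  have h := deriv_comp_const_sub (f := f) T (T / 2)
  rw [hsymm, show T - T / 2 = T / 2 by ring] at h
  linarith

/-- For a solution starting from rest with minimal positive period `T`, the time
`t = T/2` is the only time in the open interval `(0, T)` at which `ż(t) = 0` and
`ρ̇(t) = 0`. -/
theorem unique_static_point_in_period (z ρ : ℝ → ℝ) (hsol : IsSolution z ρ)
    (hz0 : deriv z 0 = 0) (hρ0 : deriv ρ 0 = 0) (T : ℝ) (hT : 0 < T)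
    (hzper : ∀ t : ℝ, z (t + T) = z t) (hρper : ∀ t : ℝ, ρ (t + T) = ρ t)
    (hmin : ∀ T' : ℝ, 0 < T' → T' < T →
      ¬((∀ t : ℝ, z (t + T') = z t) ∧ (∀ t : ℝ, ρ (t + T') = ρ t))) :
    ∀ t : ℝ, t ∈ Set.Ioo 0 T → ((deriv z t = 0 ∧ deriv ρ t = 0) ↔ t = T / 2) := by
  have heven (t : ℝ) : z (-t) = z t ∧ ρ (-t) = ρ t := by
    simpa using hsol.reflect hz0 hρ0 t
  rintro t ⟨ht0, htT⟩
  constructor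
  · rintro ⟨hz, hρ⟩
    have hper (x : ℝ) : z (x + 2 * t) = z x ∧ ρ (x + 2 * t) = ρ x := by
      have h := hsol.reflect hz hρ (-x)
      rw [(heven x).1, (heven x).2, show 2 * t - -x = x + 2 * t by ring] at h
      exact h
    rcases lt_trichotomy (2 * t) T with hlt | heq | hgt
    · exact absurd ⟨fun x => (hper x).1, fun x => (hper x).2⟩ (hmin (2 * t) (by linarith) hlt)
    · linarith
    · have hshift (x : ℝ) : x + (2 * t - T) + T = x + 2 * t := by ring
      refine absurd ⟨fun x => ?_, fun x => ?_⟩ (hmin (2 * t - T) (by linarith) (by linarith))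
      · rw [← hzper, hshift, (hper x).1]
      · rw [← hρper, hshift, (hper x).2]
  · rintro rfl
    exact ⟨deriv_half_period_eq_zero (fun t => (heven t).1) hzper,
      deriv_half_period_eq_zero (fun t => (heven t).2) hρper⟩
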